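/- Let E be a normed space and 1 ≤ p ≤ q < ∞. The composition operator C_f generated by f : E → E maps BV_p([a,b],E) into BV_q([a,b],E) if and only if f is Hölder continuous on precompact subsets of E with exponent p/q. -/

import Mathlib

open scoped ENNReal NNReal

/-- The Wiener `p`-variation of `x : ℝ → E` over `[a,b]`: the supremum over all
finite partitions `a = t₀ < … < tₙ = b` of `∑ᵢ ‖x(tᵢ) - x(tᵢ₋₁)‖ ^ p`. -/
noncomputable def pVar {E : Type*} [NormedAddCommGroup E] (p a b : ℝ) (x : ℝ → E) : ℝ≥0∞ :=
  ⨆ (n : ℕ) (t : Fin (n + 1) → ℝ) (_ : StrictMono t) (_ : t 0 = a)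
    (_ : t (Fin.last n) = b),
    ∑ i : Fin n, (‖x (t i.succ) - x (t i.castSucc)‖₊ : ℝ≥0∞) ^ p

open Filter Topology

section

variable {E : Type*} [NormedAddCommGroup E]

lemma coe_nnnorm_rpow_eq_ofReal {p : ℝ} (hp : 0 ≤ p) (v : E) :
    (‖v‖₊ : ℝ≥0∞) ^ p = ENNReal.ofReal (‖v‖ ^ p) := by
  rw [← ENNReal.ofReal_rpow_of_nonneg (norm_nonneg v) hp, ofReal_norm]
  rfl

lemma sum_le_pVar_of_endpoints {p a b : ℝ} (x : ℝ → E) {n : ℕ} {t : Fin (n + 1) → ℝ}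
    (ht : StrictMono t) (h0 : t 0 = a) (h1 : t (Fin.last n) = b) :
    ∑ i : Fin n, (‖x (t i.succ) - x (t i.castSucc)‖₊ : ℝ≥0∞) ^ p ≤ pVar p a b x := by
  unfold pVar
  exact le_iSup_of_le n <| le_iSup_of_le t <| le_iSup_of_le ht <| le_iSup_of_le h0 <|
    le_iSup_of_le h1 le_rfl

lemma sum_le_pVar_of_last {p a b : ℝ} (x : ℝ → E) {n : ℕ} {t : Fin (n + 1) → ℝ}
    (ht : StrictMono t) (h0 : a ≤ t 0) (h1 : t (Fin.last n) = b) :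
    ∑ i : Fin n, (‖x (t i.succ) - x (t i.castSucc)‖₊ : ℝ≥0∞) ^ p ≤ pVar p a b x := by
  rcases h0.eq_or_lt with h | h
  · exact sum_le_pVar_of_endpoints x ht h.symm h1
  · have hs : StrictMono (Fin.cons a t : Fin (n + 1 + 1) → ℝ) := by
      rw [Fin.strictMono_iff_lt_succ]
      intro i
      refine Fin.cases ?_ (fun j => ?_) i
      · simpa using h
      · rw [← Fin.succ_castSucc, Fin.cons_succ, Fin.cons_succ]
        exact ht j.castSucc_lt_succ
    refine le_trans ?_ (sum_le_pVar_of_endpoints (a := a) (b := b) x hs (by simp) ?_)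
    · rw [Fin.sum_univ_succ]
      simp only [← Fin.succ_castSucc, Fin.cons_succ]
      exact le_add_self
    · rw [← Fin.succ_last, Fin.cons_succ, h1]

/-- The sum over a chain of points of `[a, b]`, not necessarily containing the endpoints, is
bounded by the variation. -/
lemma sum_le_pVar {p a b : ℝ} (x : ℝ → E) {n : ℕ} {t : Fin (n + 1) → ℝ}
    (ht : StrictMono t) (h0 : a ≤ t 0) (h1 : t (Fin.last n) ≤ b) :
    ∑ i : Fin n, (‖x (t i.succ) - x (t i.castSucc)‖₊ : ℝ≥0∞) ^ p ≤ pVar p a b x := by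
  rcases h1.eq_or_lt with h | h
  · exact sum_le_pVar_of_last x ht h0 h
  · have hs : StrictMono (Fin.snoc t b : Fin (n + 1 + 1) → ℝ) := by
      rw [Fin.strictMono_iff_lt_succ]
      intro i
      refine Fin.lastCases ?_ (fun j => ?_) i
      · rw [Fin.succ_last, Fin.snoc_last, Fin.snoc_castSucc]
        exact h
      · rw [Fin.succ_castSucc, Fin.snoc_castSucc, Fin.snoc_castSucc]
        exact ht j.castSucc_lt_succ
    refine le_trans ?_ (sum_le_pVar_of_last (a := a) (b := b) x hs ?_ (by simp))
    · rw [Fin.sum_univ_castSucc]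
      simp only [Fin.succ_castSucc, Fin.snoc_castSucc]
      exact le_self_add
    · rw [← Fin.castSucc_zero, Fin.snoc_castSucc]
      exact h0

lemma Fin.sum_succ_sub_castSucc {n : ℕ} (g : Fin (n + 1) → ℝ) :
    ∑ i : Fin n, (g i.succ - g i.castSucc) = g (Fin.last n) - g 0 := by
  induction n with
  | zero => simp
  | succ n ih =>
    rw [Fin.sum_univ_castSucc]
    have := ih (fun i => g i.castSucc)
    simp only [Fin.succ_castSucc, Fin.succ_last, Fin.castSucc_zero] at this ⊢
    rw [this]
    ring

/-- A function whose increments are controlled by those of a real function `Φ` has finite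
`p`-variation. -/
lemma pVar_ne_top_of_control {p a b : ℝ} (hp : 0 ≤ p) {x : ℝ → E} (Φ : ℝ → ℝ)
    (h : ∀ s t, a ≤ s → s < t → t ≤ b → ‖x t - x s‖ ^ p ≤ Φ t - Φ s) :
    pVar p a b x ≠ ⊤ := by
  refine ne_top_of_le_ne_top (ENNReal.ofReal_ne_top (r := Φ b - Φ a)) ?_
  unfold pVar
  refine iSup_le fun n => iSup_le fun t => iSup_le fun ht => iSup_le fun h0 => iSup_le fun h1 => ?_
  simp only [coe_nnnorm_rpow_eq_ofReal hp]
  rw [← ENNReal.ofReal_sum_of_nonneg (fun i _ => by positivity)]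
  refine ENNReal.ofReal_le_ofReal ?_
  rw [← h0, ← h1, ← Fin.sum_succ_sub_castSucc (fun i => Φ (t i))]
  refine Finset.sum_le_sum fun i _ => h _ _ ?_ (ht i.castSucc_lt_succ) ?_
  · rw [← h0]; exact ht.monotone (Fin.zero_le _)
  · rw [← h1]; exact ht.monotone (Fin.le_last _)

/-- A function of finite `p`-variation has totally bounded range: infinitely many times in `[a, b]`
cannot have uniformly separated values. -/
lemma totallyBounded_image_of_pVar_ne_top {p a b : ℝ} (hp : 0 < p) {x : ℝ → E}
    (hx : pVar p a b x ≠ ⊤) : TotallyBounded (x '' Set.Icc a b) := by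
  rw [Metric.totallyBounded_iff]
  by_contra! hcon
  obtain ⟨ε, hε, hcov⟩ := hcon
  have step : ∀ F : Finset ℝ, (∀ r ∈ F, r ∈ Set.Icc a b) →
      ∃ s ∈ Set.Icc a b, ∀ r ∈ F, ε ≤ ‖x s - x r‖ := by
    intro F _
    have := hcov (x '' (F : Set ℝ)) (F.finite_toSet.image x)
    rw [Set.not_subset] at this
    obtain ⟨_, ⟨s, hs, rfl⟩, hn⟩ := this
    refine ⟨s, hs, fun r hr => ?_⟩
    by_contra! hlt
    exact hn (Set.mem_biUnion (Set.mem_image_of_mem x hr) (by simpa [dist_eq_norm] using hlt))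
  obtain ⟨s, hs, hsep⟩ := exists_seq_of_forall_finset_exists (fun r => r ∈ Set.Icc a b)
    (fun r s => ε ≤ ‖x s - x r‖) step
  have hne : ∀ m n, m ≠ n → ε ≤ ‖x (s m) - x (s n)‖ := by
    intro m n hmn
    rcases hmn.lt_or_gt with h | h
    · rw [norm_sub_rev]; exact hsep _ _ h
    · exact hsep _ _ h
  have hinj : Function.Injective s := by
    intro m n hmn
    by_contra hc
    have := hne m n hc
    rw [hmn, sub_self, norm_zero] at this
    linarith
  have chain : ∀ n : ℕ, (n : ℝ≥0∞) * ENNReal.ofReal (ε ^ p) ≤ pVar p a b x := by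
    intro n
    classical
    set F : Finset ℝ := (Finset.range (n + 1)).image s with hF
    have hcard : F.card = n + 1 := by
      rw [hF, Finset.card_image_of_injective _ hinj, Finset.card_range]
    have hmem : ∀ i, ∃ k, s k = F.orderEmbOfFin hcard i := by
      intro i
      obtain ⟨k, -, hk⟩ := Finset.mem_image.1 (F.orderEmbOfFin_mem hcard i)
      exact ⟨k, hk⟩
    choose k hk using hmem
    have hI : ∀ i, F.orderEmbOfFin hcard i ∈ Set.Icc a b := fun i => hk i ▸ hs (k i)
    refine le_trans ?_ (sum_le_pVar (t := F.orderEmbOfFin hcard) x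
      (F.orderEmbOfFin hcard).strictMono (hI _).1 (hI _).2)
    calc (n : ℝ≥0∞) * ENNReal.ofReal (ε ^ p) = ∑ _i : Fin n, ENNReal.ofReal (ε ^ p) := by simp
      _ ≤ _ := by
        refine Finset.sum_le_sum fun i _ => ?_
        rw [coe_nnnorm_rpow_eq_ofReal hp.le]
        refine ENNReal.ofReal_le_ofReal (Real.rpow_le_rpow hε.le ?_ hp.le)
        rw [← hk, ← hk]
        refine hne _ _ fun hc => ?_
        have h2 := (F.orderEmbOfFin hcard).strictMono i.castSucc_lt_succ
        rw [← hk, ← hk, hc] at h2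
        exact lt_irrefl _ h2
  have hpos : ENNReal.ofReal (ε ^ p) ≠ 0 := by
    simpa using Real.rpow_pos_of_pos hε p
  obtain ⟨n, hn⟩ := ENNReal.exists_nat_mul_gt hpos hx
  exact absurd (chain n) (not_le.2 hn)

lemma pVar_comp_ne_top_of_holder {p q a b : ℝ} (hp : 0 < p) (hq : 0 < q) {f : E → E}
    {x : ℝ → E} (hx : pVar p a b x ≠ ⊤) {L : ℝ} (hL : 0 ≤ L)
    (hf : ∀ u ∈ x '' Set.Icc a b, ∀ w ∈ x '' Set.Icc a b, ‖f u - f w‖ ≤ L * ‖u - w‖ ^ (p / q)) :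
    pVar q a b (fun t => f (x t)) ≠ ⊤ := by
  refine ne_top_of_le_ne_top (ENNReal.mul_ne_top (ENNReal.ofReal_ne_top (r := L ^ q)) hx) ?_
  conv_lhs => unfold pVar
  refine iSup_le fun n => iSup_le fun t => iSup_le fun ht => iSup_le fun h0 => iSup_le fun h1 => ?_
  refine le_trans ?_ (mul_le_mul_right (sum_le_pVar_of_endpoints x ht h0 h1) _)
  have hI : ∀ i, x (t i) ∈ x '' Set.Icc a b := fun i => Set.mem_image_of_mem _
    ⟨h0 ▸ ht.monotone (Fin.zero_le _), h1 ▸ ht.monotone (Fin.le_last _)⟩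
  rw [Finset.mul_sum]
  refine Finset.sum_le_sum fun i _ => ?_
  rw [coe_nnnorm_rpow_eq_ofReal hp.le, coe_nnnorm_rpow_eq_ofReal hq.le,
    ← ENNReal.ofReal_mul (by positivity)]
  refine ENNReal.ofReal_le_ofReal ?_
  calc _ ≤ (L * ‖x (t i.succ) - x (t i.castSucc)‖ ^ (p / q)) ^ q :=
        Real.rpow_le_rpow (norm_nonneg _) (hf _ (hI _) _ (hI _)) hq.le
    _ = _ := by
        rw [Real.mul_rpow hL (by positivity), ← Real.rpow_mul (norm_nonneg _),
          div_mul_cancel₀ _ hq.ne']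

/-- On `[n, n + 1)` this function splits the interval into `N n + 1` equal pieces and takes the
values `u n` and `w n` alternately on them. -/
noncomputable def blockOscillation {X : Type*} (u w : ℕ → X) (N : ℕ → ℕ) (s : ℝ) : X :=
  if Even ⌊((N ⌊s⌋₊ : ℝ) + 1) * (s - ⌊s⌋₊)⌋₊ then u ⌊s⌋₊ else w ⌊s⌋₊

lemma blockOscillation_eq_or {X : Type*} (u w : ℕ → X) (N : ℕ → ℕ) (s : ℝ) :
    blockOscillation u w N s = u ⌊s⌋₊ ∨ blockOscillation u w N s = w ⌊s⌋₊ := by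
  unfold blockOscillation
  split_ifs <;> simp

lemma blockOscillation_apply {X : Type*} (u w : ℕ → X) (N : ℕ → ℕ) (n i : ℕ) (hi : i ≤ N n) :
    blockOscillation u w N (n + i / ((N n : ℝ) + 1)) = if Even i then u n else w n := by
  have hN : (0 : ℝ) < (N n : ℝ) + 1 := by positivity
  have hi' : (i : ℝ) ≤ N n := by exact_mod_cast hi
  have h1 : ⌊(n : ℝ) + i / ((N n : ℝ) + 1)⌋₊ = n := by
    rw [Nat.floor_eq_iff (by positivity)]
    refine ⟨by simp; positivity, ?_⟩
    have : (i : ℝ) / ((N n : ℝ) + 1) < 1 := by rw [div_lt_one hN]; linarith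
    linarith
  unfold blockOscillation
  rw [h1, add_sub_cancel_left, mul_div_cancel₀ _ hN.ne', Nat.floor_natCast]

/-- The oscillating function has bounded control when the block costs are summable. -/
lemma exists_control_blockOscillation {p : ℝ} (hp : 0 < p) {u w : ℕ → E} {N : ℕ → ℕ} {e : ℕ → ℝ}
    (he : ∀ n, 0 ≤ e n)
    (huw : ∀ n m, n < m → ∀ y ∈ ({u n, w n} : Set E), ∀ z ∈ ({u m, w m} : Set E),
      ‖z - y‖ ^ p ≤ e n)
    (hsum : Summable fun n => N n * ‖u n - w n‖ ^ p + e n) :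
    ∃ (Ψ : ℝ → ℝ) (B : ℝ), (∀ s, 0 ≤ s → Ψ s ≤ B) ∧ ∀ s t, 0 ≤ s → s < t →
      ‖blockOscillation u w N t - blockOscillation u w N s‖ ^ p ≤ Ψ t - Ψ s := by
  set D : ℕ → ℝ := fun n => ‖u n - w n‖ ^ p with hD
  set c : ℕ → ℝ := fun n => N n * D n + e n with hc
  have hD0 : ∀ n, 0 ≤ D n := fun n => by positivity
  have hc0 : ∀ n, 0 ≤ c n := fun n => add_nonneg (mul_nonneg (by positivity) (hD0 n)) (he n)
  set k : ℝ → ℕ := fun s => ⌊((N ⌊s⌋₊ : ℝ) + 1) * (s - ⌊s⌋₊)⌋₊ with hk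
  have hkN : ∀ s, 0 ≤ s → k s ≤ N ⌊s⌋₊ := by
    intro s hs
    refine Nat.le_of_lt_succ ((Nat.floor_lt ?_).2 ?_)
    · exact mul_nonneg (by positivity) (sub_nonneg.2 (Nat.floor_le hs))
    · have := Nat.lt_floor_add_one s
      have h2 : (0 : ℝ) < (N ⌊s⌋₊ : ℝ) + 1 := by positivity
      push_cast
      nlinarith
  have hkD : ∀ s, 0 ≤ s → (k s : ℝ) * D ⌊s⌋₊ ≤ N ⌊s⌋₊ * D ⌊s⌋₊ := fun s hs =>
    mul_le_mul_of_nonneg_right (by exact_mod_cast hkN s hs) (hD0 _)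
  refine ⟨fun s => ∑ j ∈ Finset.range ⌊s⌋₊, c j + k s * D ⌊s⌋₊, ∑' j, c j, ?_, ?_⟩
  · intro s hs
    refine le_trans ?_ (hsum.sum_le_tsum (Finset.range (⌊s⌋₊ + 1)) (fun i _ => hc0 i))
    rw [Finset.sum_range_succ]
    have := hkD s hs
    have := he ⌊s⌋₊
    simp only [hc]
    linarith
  · intro s t hs hst
    have hmono : ⌊s⌋₊ ≤ ⌊t⌋₊ := Nat.floor_mono hst.le
    rcases hmono.eq_or_lt with heq | hlt
    · have hkm : k s ≤ k t := by
        simp only [hk, ← heq]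
        exact Nat.floor_mono (by gcongr)
      simp only [← heq]
      by_cases hkk : k s = k t
      · have : blockOscillation u w N t = blockOscillation u w N s := by
          unfold blockOscillation
          simp only [hk] at hkk
          rw [← hkk, ← heq]
        rw [this, sub_self, norm_zero, Real.zero_rpow hp.ne', hkk]
        simp
      · have h1 : (k s : ℝ) + 1 ≤ k t := by exact_mod_cast lt_of_le_of_ne hkm hkk
        have h2 : ‖blockOscillation u w N t - blockOscillation u w N s‖ ^ p ≤ D ⌊s⌋₊ := by
          have hz : ‖(0 : E)‖ ^ p ≤ D ⌊s⌋₊ := by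
            rw [norm_zero, Real.zero_rpow hp.ne']; exact hD0 _
          rcases blockOscillation_eq_or u w N s with h | h <;>
          rcases blockOscillation_eq_or u w N t with h' | h' <;> rw [h, h', ← heq]
          · rwa [sub_self]
          · rw [norm_sub_rev]
          · rwa [sub_self]
        have := mul_le_mul_of_nonneg_right h1 (hD0 ⌊s⌋₊)
        linarith
    · have h1 : ‖blockOscillation u w N t - blockOscillation u w N s‖ ^ p ≤ e ⌊s⌋₊ :=
        huw _ _ hlt _ (by simpa using blockOscillation_eq_or u w N s) _
          (by simpa using blockOscillation_eq_or u w N t)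
      have h2 : ∑ j ∈ Finset.range (⌊s⌋₊ + 1), c j ≤ ∑ j ∈ Finset.range ⌊t⌋₊, c j :=
        Finset.sum_le_sum_of_subset_of_nonneg (Finset.range_mono hlt) (fun i _ _ => hc0 i)
      rw [Finset.sum_range_succ] at h2
      have h3 := hkD s hs
      have h4 : 0 ≤ (k t : ℝ) * D ⌊t⌋₊ := mul_nonneg (by positivity) (hD0 _)
      have h5 : c ⌊s⌋₊ = N ⌊s⌋₊ * D ⌊s⌋₊ + e ⌊s⌋₊ := rfl
      linarith

/-- Existence of a function on `[a, b]` with finite `p`-variation that jumps `N n` times between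
`u n` and `w n`. -/
lemma exists_pVar_ne_top_oscillating {p a b : ℝ} (hp : 0 < p) (hab : a < b) {u w : ℕ → E}
    {N : ℕ → ℕ} {e : ℕ → ℝ} {M : ℝ} (he : ∀ n, 0 ≤ e n)
    (huw : ∀ n m, n < m → ∀ y ∈ ({u n, w n} : Set E), ∀ z ∈ ({u m, w m} : Set E),
      ‖z - y‖ ^ p ≤ e n)
    (hM : ∀ m, ∀ z ∈ ({u m, w m} : Set E), ‖u 0 - z‖ ^ p ≤ M)
    (hsum : Summable fun n => N n * ‖u n - w n‖ ^ p + e n) :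
    ∃ x : ℝ → E, pVar p a b x ≠ ⊤ ∧ ∀ (q : ℝ) (f : E → E) (n : ℕ),
      (N n : ℝ≥0∞) * (‖f (u n) - f (w n)‖₊ : ℝ≥0∞) ^ q ≤ pVar q a b (fun t => f (x t)) := by
  obtain ⟨Ψ, B, hB, hΨ⟩ := exists_control_blockOscillation hp he huw hsum
  have hab' : 0 < b - a := sub_pos.2 hab
  classical
  refine ⟨fun t => if t < b then blockOscillation u w N ((t - a) / (b - t)) else u 0, ?_, ?_⟩
  · refine pVar_ne_top_of_control hp.le
      (fun t => if t < b then Ψ ((t - a) / (b - t)) else B + M) ?_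
    intro s t has hst htb
    have hsb : s < b := hst.trans_le htb
    have hs0 : 0 ≤ (s - a) / (b - s) := div_nonneg (by linarith) (by linarith)
    simp only [hsb, if_true]
    rcases htb.eq_or_lt with rfl | htb
    · simp only [lt_irrefl, if_false]
      have := hB _ hs0
      have := hM _ _ (by simpa using blockOscillation_eq_or u w N ((s - a) / (t - s)))
      linarith
    · simp only [htb, if_true]
      refine hΨ _ _ hs0 ?_
      rw [div_lt_div_iff₀ (by linarith) (by linarith)]
      nlinarith
  · intro q f n
    set σ : ℕ → ℝ := fun i => n + i / ((N n : ℝ) + 1) with hσ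
    have hσ0 : ∀ i, 0 < 1 + σ i := fun i => by positivity
    set τ : ℕ → ℝ := fun i => (a + σ i * b) / (1 + σ i) with hτ
    have hbτ : ∀ i, b - τ i = (b - a) / (1 + σ i) := fun i => by
      have := (hσ0 i).ne'
      simp only [hτ]; field_simp; ring
    have hτa : ∀ i, τ i - a = σ i * (b - a) / (1 + σ i) := fun i => by
      have := (hσ0 i).ne'
      simp only [hτ]; field_simp; ring
    have hτb : ∀ i, τ i < b := fun i => by
      have := hbτ i
      have : 0 < (b - a) / (1 + σ i) := div_pos hab' (hσ0 i)
      linarith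
    have hval : ∀ i, (τ i - a) / (b - τ i) = σ i := fun i => by
      have := (hσ0 i).ne'
      rw [hbτ, hτa]; field_simp
    have hmono : StrictMono τ := by
      refine strictMono_nat_of_lt_succ fun i => ?_
      have h1 : σ i < σ (i + 1) := by
        simp only [hσ]; gcongr; simp
      have : (b - a) / (1 + σ (i + 1)) < (b - a) / (1 + σ i) :=
        div_lt_div_of_pos_left hab' (hσ0 i) (by linarith)
      linarith [hbτ i, hbτ (i + 1)]
    have hτa0 : ∀ i, a ≤ τ i := fun i => by
      have : 0 ≤ σ i * (b - a) / (1 + σ i) := by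
        have := hσ0 i
        have : 0 ≤ σ i := by positivity
        positivity
      linarith [hτa i]
    refine le_trans ?_ (sum_le_pVar (n := N n) (t := fun i => τ i) _
      (fun i j hij => hmono hij) (hτa0 _) (hτb _).le)
    simp only [hτb, if_true, hval]
    calc (N n : ℝ≥0∞) * (‖f (u n) - f (w n)‖₊ : ℝ≥0∞) ^ q
        = ∑ _i : Fin (N n), (‖f (u n) - f (w n)‖₊ : ℝ≥0∞) ^ q := by simp
      _ ≤ _ := by
        refine Finset.sum_le_sum fun i _ => le_of_eq ?_
        simp only [hσ]
        rw [blockOscillation_apply _ _ _ _ _ (by simp),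
          blockOscillation_apply _ _ _ _ _ (by simp)]
        simp only [Fin.val_succ, Fin.val_castSucc, Nat.even_add_one]
        by_cases hev : Even (i : ℕ)
        · simp only [hev, not_true, if_true, if_false]
          rw [← nnnorm_neg, neg_sub]
        · simp only [hev, not_false_iff, if_true, if_false]

/-- A sequence in a totally bounded set clusters at a point of the completion. -/
lemma exists_frequently_norm_coe_sub_lt {K : Set E} (hK : TotallyBounded K)
    {v : ℕ → E} (hv : ∀ n, v n ∈ K) :
    ∃ z : UniformSpace.Completion E, ∀ ε > 0, ∀ m : ℕ, ∃ k ≥ m,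
      ‖(v k : UniformSpace.Completion E) - z‖ < ε := by
  have hc : IsCompact (closure ((fun y : E => (y : UniformSpace.Completion E)) '' K)) :=
    (hK.image (UniformSpace.Completion.uniformContinuous_coe E)).closure.isCompact_of_isClosed
      isClosed_closure
  obtain ⟨z, -, φ, hφ, hz⟩ := hc.tendsto_subseq
    (x := fun n => (v n : UniformSpace.Completion E))
    (fun n => subset_closure (Set.mem_image_of_mem _ (hv n)))
  refine ⟨z, fun ε hε m => ?_⟩
  obtain ⟨n, h1, h2⟩ := ((Metric.tendsto_nhds.1 hz ε hε).and (eventually_ge_atTop m)).exists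
  exact ⟨φ n, h2.trans (hφ.id_le n), by simpa [dist_eq_norm] using h1⟩

/-- A composition operator from `BV_p` to `BV_q` excludes pairs of points in a totally bounded set
that come arbitrarily close while the Hölder quotient blows up. -/
lemma not_forall_holder_quotient_ge {p q a b : ℝ} (hp : 1 ≤ p) (hq : 1 ≤ q) (hab : a < b)
    {f : E → E}
    (hf : ∀ x : ℝ → E, pVar p a b x ≠ ⊤ → pVar q a b (fun t => f (x t)) ≠ ⊤)
    {K : Set E} (hK : TotallyBounded K) :
    ¬ ∀ n : ℕ, ∃ u ∈ K, ∃ w ∈ K, u ≠ w ∧ ‖u - w‖ ≤ 1 / ((n : ℝ) + 1) ∧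
      n * ‖u - w‖ ^ (p / q) ≤ ‖f u - f w‖ := by
  intro h
  choose u' hu' w' hw' hne' hd' hfq' using h
  obtain ⟨z, hz⟩ := exists_frequently_norm_coe_sub_lt hK hu'
  choose k hk hkz using fun n : ℕ => hz ((1 / 2) ^ n) (by positivity) (4 ^ n)
  have hp0 : 0 < p := by linarith
  have hq0 : 0 < q := by linarith
  set u : ℕ → E := fun n => u' (k n) with hu
  set w : ℕ → E := fun n => w' (k n) with hw
  set D : ℕ → ℝ := fun n => ‖u n - w n‖ ^ p with hDdef
  have hk4 : ∀ n, (4 : ℝ) ^ n ≤ k n := fun n => by exact_mod_cast hk n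
  have hpos : ∀ n, 0 < ‖u n - w n‖ := fun n => norm_pos_iff.2 (sub_ne_zero.2 (hne' (k n)))
  have hd : ∀ n, ‖u n - w n‖ ≤ (1 / 2) ^ n := by
    intro n
    refine (hd' (k n)).trans ?_
    rw [one_div_pow]
    have h2 : (2 : ℝ) ^ n ≤ 4 ^ n := by gcongr; norm_num
    exact one_div_le_one_div_of_le (by positivity) (by linarith [hk4 n])
  have hhalf : ∀ n : ℕ, ((1 : ℝ) / 2) ^ n ≤ 1 := fun n => pow_le_one₀ (by norm_num) (by norm_num)
  have hDpos : ∀ n, 0 < D n := fun n => Real.rpow_pos_of_pos (hpos n) p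
  have hD : ∀ n, D n ≤ (1 / 2) ^ n := fun n =>
    (Real.rpow_le_self_of_le_one (hpos n).le ((hd n).trans (hhalf n)) hp).trans (hd n)
  have hnear : ∀ n, ∀ y ∈ ({u n, w n} : Set E),
      ‖(y : UniformSpace.Completion E) - z‖ ≤ 2 * (1 / 2) ^ n := by
    intro n y hy
    have h0 : (0 : ℝ) < (1 / 2) ^ n := by positivity
    have h1 := (hkz n).le
    rcases hy with rfl | rfl
    · linarith
    · have h2 : ‖((w n : E) : UniformSpace.Completion E) - (u n : E)‖ ≤ (1 / 2) ^ n := by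
        rw [← UniformSpace.Completion.coe_sub, UniformSpace.Completion.norm_coe, norm_sub_rev]
        exact hd n
      have := norm_sub_le_norm_sub_add_norm_sub ((w n : E) : UniformSpace.Completion E) (u n : E) z
      linarith
  have hclose : ∀ n m, n ≤ m → ∀ y ∈ ({u n, w n} : Set E), ∀ z ∈ ({u m, w m} : Set E),
      ‖z - y‖ ^ p ≤ 4 ^ p * (1 / 2) ^ n := by
    intro n m hnm y hy y' hy'
    have h1 := hnear n y hy
    have h2 := hnear m y' hy'
    have h3 : ((1 : ℝ) / 2) ^ m ≤ (1 / 2) ^ n :=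
      pow_le_pow_of_le_one (by norm_num) (by norm_num) hnm
    have h4 : ‖y' - y‖ ≤ 4 * (1 / 2) ^ n := by
      rw [← UniformSpace.Completion.norm_coe, UniformSpace.Completion.coe_sub]
      have := norm_sub_le_norm_sub_add_norm_sub (y' : UniformSpace.Completion E) z y
      rw [norm_sub_rev z] at this
      linarith
    calc ‖y' - y‖ ^ p ≤ (4 * (1 / 2) ^ n) ^ p := Real.rpow_le_rpow (norm_nonneg _) h4 hp0.le
      _ = 4 ^ p * ((1 / 2) ^ n) ^ p := Real.mul_rpow (by norm_num) (by positivity)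
      _ ≤ _ := by
        gcongr
        exact Real.rpow_le_self_of_le_one (by positivity) (hhalf n) hp
  set N : ℕ → ℕ := fun n => ⌈(1 / 2) ^ n / D n⌉₊ with hN
  have hN1 : ∀ n, (1 / 2) ^ n ≤ N n * D n := fun n =>
    (div_le_iff₀ (hDpos n)).1 (Nat.le_ceil _)
  have hN2 : ∀ n, N n * D n ≤ 2 * (1 / 2) ^ n := by
    intro n
    have h1 := mul_le_mul_of_nonneg_right
      (Nat.ceil_lt_add_one (a := (1 / 2) ^ n / D n) (by have := hDpos n; positivity)).le (hDpos n).le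
    rw [add_mul, div_mul_cancel₀ _ (hDpos n).ne'] at h1
    have := hD n
    simp only [hN]
    linarith
  have hsum : Summable fun n => N n * D n + 4 ^ p * (1 / 2) ^ n := by
    refine Summable.add (Summable.of_nonneg_of_le (fun n => ?_) hN2 ?_) ?_
    · have := hDpos n; positivity
    · exact summable_geometric_two.mul_left 2
    · exact summable_geometric_two.mul_left _
  obtain ⟨x, hx, hlow⟩ := exists_pVar_ne_top_oscillating hp0 hab (u := u) (w := w) (N := N)
    (M := 4 ^ p) (fun n => by positivity) (fun n m hnm => hclose n m hnm.le)
    (fun m y hy => by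
      rw [norm_sub_rev]
      simpa using hclose 0 m (Nat.zero_le _) (u 0) (by simp) y hy) hsum
  have hbig : ∀ n : ℕ, (n : ℝ≥0∞) ≤ pVar q a b (fun t => f (x t)) := by
    intro n
    refine le_trans ?_ (hlow q f n)
    rw [coe_nnnorm_rpow_eq_ofReal hq0.le, ← ENNReal.ofReal_natCast, ← ENNReal.ofReal_natCast,
      ← ENNReal.ofReal_mul (by positivity)]
    refine ENNReal.ofReal_le_ofReal ?_
    have h4 : (1 : ℝ) ≤ 4 ^ n := one_le_pow₀ (by norm_num)
    have h1 : 4 ^ n * D n ≤ ‖f (u n) - f (w n)‖ ^ q := by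
      calc 4 ^ n * D n ≤ (4 ^ n) ^ q * D n :=
            mul_le_mul_of_nonneg_right (Real.self_le_rpow_of_one_le h4 hq) (hDpos n).le
        _ = (4 ^ n * ‖u n - w n‖ ^ (p / q)) ^ q := by
            rw [Real.mul_rpow (by positivity) (by positivity), ← Real.rpow_mul (norm_nonneg _),
              div_mul_cancel₀ _ hq0.ne']
        _ ≤ _ := by
            refine Real.rpow_le_rpow (by positivity) (le_trans ?_ (hfq' (k n))) hq0.le
            exact mul_le_mul_of_nonneg_right (hk4 n) (by positivity)
    calc (n : ℝ) ≤ 2 ^ n := by exact_mod_cast Nat.lt_two_pow_self.le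
      _ = 4 ^ n * (1 / 2) ^ n := by rw [← mul_pow]; norm_num
      _ ≤ 4 ^ n * (N n * D n) := by gcongr; exact hN1 n
      _ = N n * (4 ^ n * D n) := by ring
      _ ≤ _ := by gcongr
  refine hf x hx (ENNReal.eq_top_of_forall_nnreal_le fun r => ?_)
  obtain ⟨n, hn⟩ := exists_nat_ge r
  refine le_trans ?_ (hbig n)
  exact_mod_cast hn

lemma exists_bound_on_totallyBounded {p q a b : ℝ} (hp : 1 ≤ p) (hq : 1 ≤ q) (hab : a < b)
    {f : E → E}
    (hf : ∀ x : ℝ → E, pVar p a b x ≠ ⊤ → pVar q a b (fun t => f (x t)) ≠ ⊤)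
    {K : Set E} (hK : TotallyBounded K) : ∃ M : ℝ, ∀ u ∈ K, ‖f u‖ ≤ M := by
  by_contra hcon
  refine not_forall_holder_quotient_ge hp hq hab hf hK fun n => ?_
  have hr : (0 : ℝ) < 1 / (2 * ((n : ℝ) + 1)) := by positivity
  obtain ⟨T, hT, hcov⟩ := Metric.totallyBounded_iff.1 hK _ hr
  have hball : ∃ c ∈ T, ¬ ∃ M : ℝ, ∀ u ∈ K ∩ Metric.ball c (1 / (2 * ((n : ℝ) + 1))), ‖f u‖ ≤ M := by
    by_contra! hall
    choose! M hM using hall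
    obtain ⟨B, hB⟩ := (hT.image M).bddAbove
    refine hcon ⟨B, fun u hu => ?_⟩
    obtain ⟨c, hc, huc⟩ := Set.mem_iUnion₂.1 (hcov hu)
    exact (hM c hc u ⟨hu, huc⟩).trans (hB (Set.mem_image_of_mem M hc))
  obtain ⟨c, -, hc⟩ := hball
  push Not at hc
  obtain ⟨u, ⟨huK, hu⟩, -⟩ := hc 0
  obtain ⟨w, ⟨hwK, hw⟩, hfw⟩ := hc (‖f u‖ + n)
  have hd : ‖u - w‖ ≤ 1 / ((n : ℝ) + 1) := by
    rw [← dist_eq_norm]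
    have h1 := dist_triangle_right u w c
    have h2 : 1 / ((n : ℝ) + 1) = 1 / (2 * ((n : ℝ) + 1)) + 1 / (2 * ((n : ℝ) + 1)) := by
      field_simp; norm_num
    rw [Metric.mem_ball] at hu hw
    linarith
  have hn : (0 : ℝ) ≤ n := n.cast_nonneg
  refine ⟨u, huK, w, hwK, ?_, hd, ?_⟩
  · rintro rfl
    linarith
  · have h1 : ‖u - w‖ ^ (p / q) ≤ 1 := by
      refine Real.rpow_le_one (norm_nonneg _) (hd.trans ?_) (by positivity)
      rw [div_le_one (by positivity)]
      linarith
    have h2 := norm_sub_norm_le (f w) (f u)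
    rw [norm_sub_rev] at h2
    nlinarith

lemma exists_holder_on_totallyBounded {p q a b : ℝ} (hp : 1 ≤ p) (hq : 1 ≤ q) (hab : a < b)
    {f : E → E}
    (hf : ∀ x : ℝ → E, pVar p a b x ≠ ⊤ → pVar q a b (fun t => f (x t)) ≠ ⊤)
    {K : Set E} (hK : TotallyBounded K) :
    ∃ L : ℝ, 0 ≤ L ∧ ∀ u ∈ K, ∀ w ∈ K, ‖f u - f w‖ ≤ L * ‖u - w‖ ^ (p / q) := by
  obtain ⟨M, hM⟩ := exists_bound_on_totallyBounded hp hq hab hf hK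
  have hα : 0 < p / q := by positivity
  by_contra! hcon
  refine not_forall_holder_quotient_ge hp hq hab hf hK fun n => ?_
  have hn : (0 : ℝ) < (n : ℝ) + 1 := by positivity
  obtain ⟨u, hu, w, hw, hlt⟩ := hcon (n + 2 * |M| * ((n : ℝ) + 1) ^ (p / q)) (by positivity)
  have hM2 : ‖f u - f w‖ ≤ 2 * |M| := by
    have := norm_sub_le (f u) (f w)
    linarith [hM u hu, hM w hw, le_abs_self M]
  have hd0 : 0 ≤ ‖u - w‖ ^ (p / q) := by positivity
  refine ⟨u, hu, w, hw, ?_, ?_, ?_⟩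
  · rintro rfl
    simp [Real.zero_rpow hα.ne'] at hlt
  · by_contra! hd
    have h1 : (1 : ℝ) ≤ ((n : ℝ) + 1) ^ (p / q) * ‖u - w‖ ^ (p / q) := by
      rw [← Real.mul_rpow hn.le (norm_nonneg _)]
      refine Real.one_le_rpow ?_ hα.le
      rw [div_lt_iff₀ hn] at hd
      linarith
    have h2 := mul_le_mul_of_nonneg_left h1 (by positivity : 0 ≤ 2 * |M|)
    have h3 : 0 ≤ (n : ℝ) * ‖u - w‖ ^ (p / q) := by positivity
    nlinarith
  · have h3 : 0 ≤ 2 * |M| * ((n : ℝ) + 1) ^ (p / q) * ‖u - w‖ ^ (p / q) := by positivity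
    nlinarith

end

/-- Josephy-type theorem: the composition operator generated by `f : E → E` maps
`BV_p([a,b],E)` into `BV_q([a,b],E)` if and only if `f` is Hölder continuous with
exponent `p/q` on every precompact (totally bounded) subset of `E`. -/
theorem comp_maps_BV_iff_holder_on_precompact {E : Type*} [NormedAddCommGroup E]
    (p q a b : ℝ) (hp : 1 ≤ p) (hpq : p ≤ q) (hab : a < b)
    (f : E → E) :
    (∀ x : ℝ → E, pVar p a b x ≠ ⊤ → pVar q a b (fun t => f (x t)) ≠ ⊤) ↔
      (∀ K : Set E, TotallyBounded K → ∃ L : ℝ, 0 ≤ L ∧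
        ∀ u ∈ K, ∀ w ∈ K, ‖f u - f w‖ ≤ L * ‖u - w‖ ^ (p / q)) := by
  have hq : 1 ≤ q := hp.trans hpq
  refine ⟨fun hf K hK => exists_holder_on_totallyBounded hp hq hab hf hK, fun hf x hx => ?_⟩
  obtain ⟨L, hL, hLf⟩ := hf _ (totallyBounded_image_of_pVar_ne_top (by linarith) hx)
  exact pVar_comp_ne_top_of_holder (by linarith) (by linarith) hx hL hLf
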